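/- Let F be a field, let t ≤ n be positive natural numbers, and let x : Fin n → F be an injective function. Let M and V be types, let Enc_M : F → (M ≃ M) and Enc_F : F → (F ≃ F) be families of bijections indexed by keys in F, and let H : V → F be a function. Given a post p ∈ M, attribute values v : Fin n → V, and a polynomial f over F of degree strictly less than t, define the protected post by c = Enc_M(f(0))(p) and the encrypted shares by c_i = Enc_F(H(v_i))(f(x_i)) for i ∈ Fin n. Then for every subset T ⊆ Fin n with |T| = t, accessing with the correct attribute values recovers the post: setting s̃_i = (Enc_F(H(v_i)))⁻¹(c_i) for i ∈ T and K̃ = Σ_{i ∈ T} s̃_i · Π_{j ∈ T, j ≠ i} x_j / (x_j − x_i), one has (Enc_M(K̃))⁻¹(c) = p. -/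

import Mathlib

open Polynomial Finset

/-- The value at `0` of a Lagrange basis polynomial. -/
lemma eval_zero_lagrange_basis {F ι : Type*} [Field F] [DecidableEq ι]
    (s : Finset ι) (x : ι → F) (i : ι) :
    (Lagrange.basis s x i).eval 0 = ∏ j ∈ s.erase i, x j / (x j - x i) := by
  rw [Lagrange.basis, eval_prod]
  refine prod_congr rfl fun j _ => ?_
  rw [Lagrange.basisDivisor, eval_mul, eval_C, eval_sub, eval_X, eval_C, zero_sub,
    ← neg_sub (x j) (x i), inv_neg, neg_mul_neg, div_eq_mul_inv, mul_comm]

/-- Lagrange interpolation at `0`: a polynomial of degree less than the number of nodes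
has its constant term determined by its values at the nodes. -/
lemma eval_zero_eq_sum_lagrange {F ι : Type*} [Field F] [DecidableEq ι]
    {s : Finset ι} {x : ι → F} (hx : Set.InjOn x s) {f : F[X]} (hf : f.degree < #s) :
    f.eval 0 = ∑ i ∈ s, f.eval (x i) * ∏ j ∈ s.erase i, x j / (x j - x i) := by
  conv_lhs => rw [Lagrange.eq_interpolate hx hf]
  simp only [Lagrange.interpolate_apply, eval_finsetSum, eval_mul, eval_C,
    eval_zero_lagrange_basis]

/-- Correctness of the concrete PKA realization: a user who supplies the correct
attribute values for any `t` of the `n` attributes decrypts the corresponding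
encrypted shares, reconstructs the master key `f(0)` by Lagrange interpolation
at `0`, and recovers the original post `p`. -/
theorem pka_access_correct {F : Type*} [Field F] (t n : ℕ)
    (ht : 0 < t) (htn : t ≤ n)
    (x : Fin n → F) (hx : Function.Injective x)
    {M V : Type*}
    (EncM : F → M ≃ M) (EncF : F → F ≃ F) (H : V → F)
    (p : M) (v : Fin n → V)
    (f : F[X]) (hf : f.degree < t)
    (c : M) (hc : c = EncM (f.eval 0) p)
    (ci : Fin n → F) (hci : ∀ i, ci i = EncF (H (v i)) (f.eval (x i)))
    (T : Finset (Fin n)) (hT : T.card = t) :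
    (EncM (∑ i ∈ T, (EncF (H (v i))).symm (ci i) *
        ∏ j ∈ T.erase i, x j / (x j - x i))).symm c = p := by
  subst hc hT
  simp only [hci, Equiv.symm_apply_apply]
  rw [← eval_zero_eq_sum_lagrange hx.injOn hf, Equiv.symm_apply_apply]
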